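/- arXiv:2507.19895 — 5 statements merged into one kernel-verified Lean document; each statement's English description precedes it below -/
import Mathlib

section
/- Let A ∈ ℝ^{n×n}, and let W, Q ∈ ℝ^{n×n} be symmetric with W ≻ 0, Q ≻ 0, and AW + WAᵀ + Q ⪯ 0. Then A is Hurwitz, i.e., every eigenvalue λ ∈ ℂ of A satisfies Re(λ) < 0. -/
open scoped Matrix

/-- if `W ≻ 0`, `Q ≻ 0` are symmetric and `AW + WAᵀ + Q ⪯ 0`, then `A` is
Hurwitz: every complex eigenvalue `μ` of `A` satisfies `Re μ < 0`. -/
theorem stmt_7 {n : ℕ} (A W Q : Matrix (Fin n) (Fin n) ℝ)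
    (hWsymm : W.IsSymm) (hQsymm : Q.IsSymm)
    (hW : W.PosDef) (hQ : Q.PosDef)
    (hLyap : (-(A * W + W * Aᵀ + Q)).PosSemidef) :
    ∀ (μ : ℂ) (v : Fin n → ℂ), v ≠ 0 → (A.map (Complex.ofReal)) *ᵥ v = μ • v → μ.re < 0 := by
  intro μ v hv h
  have hsym : ∀ x y : Fin n → ℝ, x ⬝ᵥ (W *ᵥ y) = y ⬝ᵥ (W *ᵥ x) := by
    intro x y
    rw [Matrix.dotProduct_mulVec, ← Matrix.mulVec_transpose, hWsymm.eq, dotProduct_comm]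
  have key : ∀ x : Fin n → ℝ, 2 * (x ⬝ᵥ (A *ᵥ (W *ᵥ x))) + x ⬝ᵥ (Q *ᵥ x) ≤ 0 := by
    intro x
    have h1 := hLyap.dotProduct_mulVec_nonneg x
    have h2 : x ⬝ᵥ (W *ᵥ (Aᵀ *ᵥ x)) = x ⬝ᵥ (A *ᵥ (W *ᵥ x)) := by
      rw [hsym, Matrix.mulVec_transpose, ← Matrix.dotProduct_mulVec]
    simp only [star_trivial, Matrix.neg_mulVec, Matrix.add_mulVec, dotProduct_neg,
      dotProduct_add, ← Matrix.mulVec_mulVec, h2] at h1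
    linarith
  have hQn : ∀ x : Fin n → ℝ, 0 ≤ x ⬝ᵥ (Q *ᵥ x) := fun x => by
    simpa using hQ.posSemidef.dotProduct_mulVec_nonneg x
  have hWn : ∀ x : Fin n → ℝ, 0 ≤ x ⬝ᵥ (W *ᵥ x) := fun x => by
    simpa using hW.posSemidef.dotProduct_mulVec_nonneg x
  have hQp : ∀ x : Fin n → ℝ, x ≠ 0 → 0 < x ⬝ᵥ (Q *ᵥ x) := fun x hx => by
    simpa using hQ.dotProduct_mulVec_pos hx
  have hsurj : ∀ a : Fin n → ℝ, ∃ p, W *ᵥ p = a := by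
    intro a
    refine ⟨W⁻¹ *ᵥ a, ?_⟩
    rw [Matrix.mulVec_mulVec, Matrix.mul_nonsing_inv _ ((Matrix.isUnit_iff_isUnit_det _).1 hW.isUnit),
      Matrix.one_mulVec]
  obtain ⟨p, hp⟩ := hsurj (fun i => (v i).re)
  obtain ⟨q, hq⟩ := hsurj (fun i => (v i).im)
  have hA1 : A *ᵥ (W *ᵥ p) = μ.re • (W *ᵥ p) - μ.im • (W *ᵥ q) := by
    rw [hp, hq]
    ext i
    have := congrArg Complex.re (congrFun h i)
    simpa [Matrix.mulVec, dotProduct, Complex.mul_re] using this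
  have hA2 : A *ᵥ (W *ᵥ q) = μ.im • (W *ᵥ p) + μ.re • (W *ᵥ q) := by
    rw [hp, hq]
    ext i
    have := congrArg Complex.im (congrFun h i)
    simp [Matrix.mulVec, dotProduct, Complex.mul_im] at this ⊢
    linarith
  have k1 := key p
  have k2 := key q
  rw [hA1] at k1
  rw [hA2] at k2
  simp only [dotProduct_add, dotProduct_sub, dotProduct_smul, smul_eq_mul] at k1 k2
  rw [hsym q p] at k2
  have hpq : p ≠ 0 ∨ q ≠ 0 := by
    by_contra hc
    push Not at hc
    apply hv
    ext i
    apply Complex.ext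
    · have := congrFun hp i
      simpa [hc.1] using this.symm
    · have := congrFun hq i
      simpa [hc.2] using this.symm
  have hpos : 0 < p ⬝ᵥ (Q *ᵥ p) + q ⬝ᵥ (Q *ᵥ q) := by
    rcases hpq with h' | h'
    · linarith [hQp p h', hQn q]
    · linarith [hQp q h', hQn p]
  by_contra hneg
  push Not at hneg
  have := mul_nonneg hneg (hWn p)
  have := mul_nonneg hneg (hWn q)
  linarith
end

section
/- Let A ∈ ℝ^{n×n} be Hurwitz and let Q ∈ ℝ^{n×n} be symmetric positive semidefinite. Then there exists a symmetric positive semidefinite W ∈ ℝ^{n×n} satisfying the Lyapunov equation AW + WAᵀ + Q = 0; moreover, if Q ≻ 0 then W ≻ 0. -/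
open scoped Matrix

attribute [local instance] Matrix.frobeniusNormedRing Matrix.frobeniusNormedAlgebra
  Matrix.frobeniusNormedAddCommGroup Matrix.frobeniusNormedSpace

theorem aux_det {n : ℕ} (A : Matrix (Fin n) (Fin n) ℝ)
    (hH : ∀ (μ : ℂ) (v : Fin n → ℂ), v ≠ 0 →
      (A.map (Complex.ofReal)) *ᵥ v = μ • v → μ.re < 0) : IsUnit (1 - A).det := by
  rw [isUnit_iff_ne_zero]
  intro h
  obtain ⟨v, hv, h0⟩ := Matrix.exists_mulVec_eq_zero_iff.mpr h
  have h1 : A *ᵥ v = v := by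
    rw [Matrix.sub_mulVec, Matrix.one_mulVec, sub_eq_zero] at h0
    exact h0.symm
  have h2 := hH 1 (fun i => (v i : ℂ)) (by
    intro h
    apply hv
    funext i
    have := congrFun h i
    simpa using this) (by
    funext i
    have := congrFun h1 i
    simp only [one_smul]
    conv_rhs => rw [← this]
    simp [Matrix.mulVec, dotProduct])
  norm_num at h2

theorem aux_norm (μ : ℂ) (h1 : μ + 1 ≠ 0) (h : ((μ - 1) / (μ + 1)).re < 0) : ‖μ‖ < 1 := by
  have hp : 0 < Complex.normSq (μ + 1) := Complex.normSq_pos.mpr h1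
  rw [Complex.div_re, ← add_div, div_lt_iff₀ hp] at h
  simp at h
  have : ‖μ‖ ^ 2 < 1 := by
    rw [← Complex.normSq_eq_norm_sq, Complex.normSq_apply]
    nlinarith
  nlinarith [norm_nonneg μ]

theorem aux_spec {n : ℕ} (A M : Matrix (Fin n) (Fin n) ℂ)
    (hH : ∀ (μ : ℂ) (v : Fin n → ℂ), v ≠ 0 → A *ᵥ v = μ • v → μ.re < 0)
    (hM : (1 - A) * M = 1) (μ : ℂ) (hμ : μ ∈ spectrum ℂ ((1 + A) * M)) : ‖μ‖ < 1 := by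
  rw [← Matrix.spectrum_toLin', ← Module.End.hasEigenvalue_iff_mem_spectrum] at hμ
  obtain ⟨v, hv⟩ := hμ.exists_hasEigenvector
  have h1 := hv.apply_eq_smul
  have h2 := hv.2
  rw [Matrix.toLin'_apply, ← Matrix.mulVec_mulVec] at h1
  have h3 : (1 - A) *ᵥ (M *ᵥ v) = v := by rw [Matrix.mulVec_mulVec, hM, Matrix.one_mulVec]
  set u := M *ᵥ v
  have hu : u ≠ 0 := by
    rintro h; apply h2; rw [← h3, h, Matrix.mulVec_zero]
  rw [← h3] at h1
  simp only [Matrix.add_mulVec, Matrix.sub_mulVec, Matrix.one_mulVec] at h1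
  have h4 : (μ + 1) • (A *ᵥ u) = (μ - 1) • u := by
    funext i
    have := congrFun h1 i
    simp at this ⊢
    linear_combination this
  have h5 : μ + 1 ≠ 0 := by
    intro h
    rw [h, zero_smul] at h4
    have : μ - 1 = -2 := by linear_combination h
    rw [this] at h4
    rcases smul_eq_zero.mp h4.symm with h | h
    · norm_num at h
    · exact hu h
  apply aux_norm μ h5
  apply hH _ u hu
  rw [div_eq_inv_mul, mul_smul, ← h4, smul_smul, inv_mul_cancel₀ h5, one_smul]

theorem aux_pow {n : ℕ} (B : Matrix (Fin n) (Fin n) ℂ)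
    (h : ∀ μ ∈ spectrum ℂ B, ‖μ‖ < 1) :
    ∃ r : ℝ, 0 ≤ r ∧ r < 1 ∧ ∀ᶠ k : ℕ in Filter.atTop, ‖B ^ k‖ ≤ r ^ k := by
  have : CompleteSpace (Matrix (Fin n) (Fin n) ℂ) := FiniteDimensional.complete ℂ _
  have hr : spectralRadius ℂ B < 1 := by
    by_cases hne : (spectrum ℂ B).Nonempty
    · have := spectrum.spectralRadius_lt_of_forall_lt_of_nonempty hne (r := 1) (fun k hk => by
        have := h k hk
        exact_mod_cast this)
      exact_mod_cast this
    · rw [Set.not_nonempty_iff_eq_empty] at hne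
      simp [spectralRadius, hne]
  obtain ⟨r, h1, h2⟩ := ENNReal.lt_iff_exists_nnreal_btwn.mp hr
  refine ⟨r, r.2, by exact_mod_cast h2, ?_⟩
  have ht := spectrum.pow_nnnorm_pow_one_div_tendsto_nhds_spectralRadius B
  filter_upwards [ht.eventually_lt_const h1, Filter.eventually_gt_atTop 0] with k hk hk0
  have h3 := ENNReal.rpow_le_rpow hk.le (z := (k : ℝ)) (by positivity)
  rw [← ENNReal.rpow_mul, one_div, inv_mul_cancel₀ (by positivity), ENNReal.rpow_one,
    ENNReal.rpow_natCast] at h3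
  have h4 : ‖B ^ k‖₊ ≤ r ^ k := by exact_mod_cast h3
  exact_mod_cast h4

theorem aux_stein {n : ℕ} (B P : Matrix (Fin n) (Fin n) ℝ) (hP : P.PosSemidef)
    (h : ∀ μ ∈ spectrum ℂ (B.map Complex.ofReal), ‖μ‖ < 1) :
    ∃ W : Matrix (Fin n) (Fin n) ℝ, W.PosSemidef ∧ W = P + B * W * Bᵀ := by
  have : CompleteSpace (Matrix (Fin n) (Fin n) ℝ) := FiniteDimensional.complete ℝ _
  obtain ⟨r, hr0, hr1, hr⟩ := aux_pow _ h
  have hn : ∀ k : ℕ, ‖B ^ k‖ = ‖(B.map Complex.ofReal) ^ k‖ := by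
    intro k
    have : (B.map Complex.ofReal) ^ k = (B ^ k).map Complex.ofReal :=
      (map_pow (Complex.ofRealHom.mapMatrix) B k).symm
    rw [this, Matrix.frobenius_norm_map_eq]
    intro a; simp
  let f : ℕ → Matrix (Fin n) (Fin n) ℝ := fun k => B ^ k * P * (B ^ k)ᵀ
  have hs : Summable f := by
    apply Summable.of_norm_bounded_eventually_nat (g := fun k => ‖P‖ * (r ^ 2) ^ k)
    · exact (summable_geometric_of_lt_one (by positivity) (by nlinarith)).mul_left _
    · filter_upwards [hr] with k hk
      rw [← hn] at hk
      calc ‖f k‖ ≤ ‖B ^ k * P‖ * ‖(B ^ k)ᵀ‖ := norm_mul_le _ _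
        _ ≤ (‖B ^ k‖ * ‖P‖) * ‖(B ^ k)ᵀ‖ := by gcongr; exact norm_mul_le _ _
        _ = ‖P‖ * (‖B ^ k‖ * ‖B ^ k‖) := by rw [Matrix.frobenius_norm_transpose]; ring
        _ ≤ ‖P‖ * (r ^ k * r ^ k) := by gcongr
        _ = _ := by ring
  have hf : ∀ k, (f k).PosSemidef := fun k => by
    have := hP.mul_mul_conjTranspose_same (B ^ k)
    simpa [f, Matrix.conjTranspose_eq_transpose_of_trivial] using this
  have hfin : ∀ s : Finset ℕ, (∑ k ∈ s, f k).PosSemidef := fun s =>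
    Matrix.posSemidef_sum s (fun k _ => hf k)
  refine ⟨∑' k, f k, ?_, ?_⟩
  · refine Matrix.PosSemidef.of_dotProduct_mulVec_nonneg ?_ ?_
    · have h1 : (∑' k, f k)ᴴ = ∑' k, (f k)ᴴ := Matrix.conjTranspose_tsum
      rw [Matrix.IsHermitian, h1]
      exact tsum_congr fun k => (hf k).1
    · intro x
      have hc : Continuous (fun M : Matrix (Fin n) (Fin n) ℝ => star x ⬝ᵥ (M *ᵥ x)) := by
        fun_prop
      exact ge_of_tendsto' ((hc.tendsto _).comp hs.hasSum) fun s =>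
        (hfin s).dotProduct_mulVec_nonneg x
  · have h1 := hs.tsum_eq_zero_add
    have h2 : ∀ k, f (k + 1) = B * f k * Bᵀ := by
      intro k
      simp only [f, pow_succ' B k, Matrix.transpose_mul, Matrix.mul_assoc]
    simp only [h2] at h1
    rw [(hs.mul_left B).tsum_mul_right, hs.tsum_mul_left] at h1
    simpa [f] using h1



/-- if `A` is Hurwitz and `Q ⪰ 0` is symmetric, then the Lyapunov equation
`AW + WAᵀ + Q = 0` has a symmetric positive semidefinite solution `W`; moreover if
`Q ≻ 0` then `W ≻ 0`. -/
theorem stmt_8 {n : ℕ} (A Q : Matrix (Fin n) (Fin n) ℝ)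
    (hQsymm : Q.IsSymm) (hQ : Q.PosSemidef)
    (hHurwitz : ∀ (μ : ℂ) (v : Fin n → ℂ), v ≠ 0 →
      (A.map (Complex.ofReal)) *ᵥ v = μ • v → μ.re < 0) :
    ∃ W : Matrix (Fin n) (Fin n) ℝ, W.IsSymm ∧ W.PosSemidef ∧
      A * W + W * Aᵀ + Q = 0 ∧ (Q.PosDef → W.PosDef) := by
  have hu := aux_det A hHurwitz
  set M := (1 - A)⁻¹ with hMdef
  have hM : (1 - A) * M = 1 := Matrix.mul_nonsing_inv _ hu
  have hM' : M * (1 - A) = 1 := Matrix.nonsing_inv_mul _ hu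
  have hPs : ((2 : ℝ) • (M * Q * Mᵀ)).PosSemidef := by
    have := hQ.mul_mul_conjTranspose_same M
    rw [Matrix.conjTranspose_eq_transpose_of_trivial] at this
    exact this.smul (by norm_num)
  obtain ⟨W, hW, hWe⟩ := aux_stein ((1 + A) * M) _ hPs (by
    have e : ((1 + A) * M).map Complex.ofReal
        = (1 + A.map Complex.ofReal) * M.map Complex.ofReal := by
      have := map_mul (Complex.ofRealHom.mapMatrix) (1 + A) M
      rw [map_add, map_one] at this
      exact this
    have e2 : (1 - A.map Complex.ofReal) * M.map Complex.ofReal = 1 := by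
      have := map_mul (Complex.ofRealHom.mapMatrix) (1 - A) M
      rw [map_sub, map_one, hM, map_one] at this
      exact this.symm
    rw [e]
    exact aux_spec _ _ hHurwitz e2)
  have hcomm : (1 - A) * ((1 + A) * M) = 1 + A := by
    have : (1 - A) * (1 + A) = (1 + A) * (1 - A) := by noncomm_ring
    rw [← mul_assoc, this, mul_assoc, hM, mul_one]
  have hsym : W.IsSymm := by
    have := hW.1
    rwa [Matrix.IsHermitian, Matrix.conjTranspose_eq_transpose_of_trivial] at this
  have hT : ∀ X Y : Matrix (Fin n) (Fin n) ℝ, (1 - A) * (X * Y * Xᵀ) * (1 - A)ᵀ =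
      ((1 - A) * X) * Y * ((1 - A) * X)ᵀ := by
    intro X Y
    simp only [Matrix.transpose_mul, mul_assoc]
  refine ⟨W, hsym, hW, ?_, ?_⟩
  · have h1 : (1 - A) * W * (1 - A)ᵀ = (2 : ℝ) • Q + (1 + A) * W * (1 + A)ᵀ := by
      conv_lhs => rw [hWe]
      rw [mul_add, add_mul, hT, hcomm, Matrix.mul_smul, Matrix.smul_mul, hT, hM]
      simp
    simp only [Matrix.transpose_sub, Matrix.transpose_add, Matrix.transpose_one] at h1
    have h2 : (2 : ℝ) • (A * W + W * Aᵀ + Q) = 0 := by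
      have h3 : (2 : ℝ) • (A * W + W * Aᵀ) =
        (1 + A) * W * (1 + Aᵀ) - (1 - A) * W * (1 - Aᵀ) := by
        rw [two_smul]; noncomm_ring
      rw [smul_add, h3, h1]; abel
    exact (smul_eq_zero.mp h2).resolve_left (by norm_num)
  · intro hQd
    rw [hWe]
    have hMu : IsUnit M := ⟨⟨M, 1 - A, hM', hM⟩, rfl⟩
    have h1 : (M * Q * Mᵀ).PosDef := by
      have := hQd.mul_mul_conjTranspose_same (B := M) (by
        exact Matrix.vecMul_injective_of_isUnit hMu)
      rwa [Matrix.conjTranspose_eq_transpose_of_trivial] at this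
    have h2 := hW.mul_mul_conjTranspose_same ((1 + A) * M)
    rw [Matrix.conjTranspose_eq_transpose_of_trivial] at h2
    exact (h1.smul (by norm_num)).add_posSemidef h2
end

section
/- Let A ∈ ℝ^{n×n} have an eigenvalue λ ∈ ℂ with Re(λ) > 0 and associated left eigenvector w ∈ ℂ^n, w ≠ 0, wᵀA = λwᵀ. Let B₂ ∈ ℝ^{n×m}, let M ∈ ℝ^{m×n} satisfy wᵀB₂M = 0, and let Q ∈ ℝ^{n×n} be symmetric positive definite. Then there is no symmetric positive definite W₁ ∈ ℝ^{n×n} satisfying AW₁ − B₂M + W₁Aᵀ − MᵀB₂ᵀ + Q ⪯ 0. -/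
open scoped Matrix

theorem aux_quad {n m : ℕ} (A W Q : Matrix (Fin n) (Fin n) ℝ)
    (B : Matrix (Fin n) (Fin m) ℝ) (M : Matrix (Fin m) (Fin n) ℝ) (hW : W.IsSymm)
    (v : Fin n → ℝ) (hv : v ᵥ* (B * M) = 0) :
    v ⬝ᵥ ((-(A * W - B * M + W * Aᵀ - Mᵀ * Bᵀ + Q)) *ᵥ v)
      = -(2 * ((v ᵥ* A) ⬝ᵥ (W *ᵥ v)) + v ⬝ᵥ (Q *ᵥ v)) := by
  have h1 : v ⬝ᵥ ((A * W) *ᵥ v) = (v ᵥ* A) ⬝ᵥ (W *ᵥ v) := by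
    rw [← Matrix.mulVec_mulVec, Matrix.dotProduct_mulVec]
  have h2 : v ⬝ᵥ ((W * Aᵀ) *ᵥ v) = (v ᵥ* A) ⬝ᵥ (W *ᵥ v) := by
    rw [← Matrix.mulVec_mulVec, Matrix.dotProduct_mulVec, Matrix.mulVec_transpose,
      ← Matrix.mulVec_transpose, hW.eq, dotProduct_comm]
  have h3 : v ⬝ᵥ ((B * M) *ᵥ v) = 0 := by
    rw [Matrix.dotProduct_mulVec, hv, zero_dotProduct]
  have h4 : v ⬝ᵥ ((Mᵀ * Bᵀ) *ᵥ v) = 0 := by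
    rw [← Matrix.transpose_mul, Matrix.mulVec_transpose, hv, dotProduct_zero]
  simp only [Matrix.neg_mulVec, Matrix.add_mulVec, Matrix.sub_mulVec, dotProduct_neg,
    dotProduct_add, dotProduct_sub, h1, h2, h3, h4]
  ring

theorem aux_re {n k : ℕ} (w : Fin n → ℂ) (A : Matrix (Fin n) (Fin k) ℝ) (j : Fin k) :
    ((w ᵥ* A.map Complex.ofReal) j).re = ((fun i => (w i).re) ᵥ* A) j := by
  simp [Matrix.vecMul, dotProduct]

theorem aux_im {n k : ℕ} (w : Fin n → ℂ) (A : Matrix (Fin n) (Fin k) ℝ) (j : Fin k) :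
    ((w ᵥ* A.map Complex.ofReal) j).im = ((fun i => (w i).im) ᵥ* A) j := by
  simp [Matrix.vecMul, dotProduct]

/-- if `A` has a left eigenvector `w ≠ 0` with eigenvalue `λ`, `Re λ > 0`,
`wᵀB₂M = 0`, and `Q ≻ 0` is symmetric, then there is no symmetric `W₁ ≻ 0` with
`AW₁ − B₂M + W₁Aᵀ − MᵀB₂ᵀ + Q ⪯ 0`. -/
theorem stmt_10 {n m : ℕ} (A : Matrix (Fin n) (Fin n) ℝ)
    (lam : ℂ) (hre : 0 < lam.re)
    (w : Fin n → ℂ) (hw : w ≠ 0)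
    (hleft : w ᵥ* (A.map (Complex.ofReal)) = lam • w)
    (B₂ : Matrix (Fin n) (Fin m) ℝ) (M : Matrix (Fin m) (Fin n) ℝ)
    (hM : w ᵥ* ((B₂ * M).map (Complex.ofReal)) = 0)
    (Q : Matrix (Fin n) (Fin n) ℝ) (hQsymm : Q.IsSymm) (hQ : Q.PosDef) :
    ¬ ∃ W₁ : Matrix (Fin n) (Fin n) ℝ, W₁.IsSymm ∧ W₁.PosDef ∧
        (-(A * W₁ - B₂ * M + W₁ * Aᵀ - Mᵀ * B₂ᵀ + Q)).PosSemidef := by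
  rintro ⟨W, hWs, hW, hneg⟩
  set x : Fin n → ℝ := fun i => (w i).re with hx
  set y : Fin n → ℝ := fun i => (w i).im with hy
  have hxA : x ᵥ* A = lam.re • x - lam.im • y := by
    ext j
    rw [← aux_re, hleft]; simp [hx, hy]
  have hyA : y ᵥ* A = lam.re • y + lam.im • x := by
    ext j
    rw [← aux_im, hleft]; simp [hx, hy]
  have hxM : x ᵥ* (B₂ * M) = 0 := by
    ext j
    rw [← aux_re, hM]; simp
  have hyM : y ᵥ* (B₂ * M) = 0 := by
    ext j
    rw [← aux_im, hM]; simp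
  have qx := hneg.dotProduct_mulVec_nonneg x
  have qy := hneg.dotProduct_mulVec_nonneg y
  have wx := hW.posSemidef.dotProduct_mulVec_nonneg x
  have wy := hW.posSemidef.dotProduct_mulVec_nonneg y
  have Qx := hQ.posSemidef.dotProduct_mulVec_nonneg x
  have Qy := hQ.posSemidef.dotProduct_mulVec_nonneg y
  simp only [star_trivial] at qx qy wx wy Qx Qy
  rw [aux_quad _ _ _ _ _ hWs _ hxM, hxA] at qx
  rw [aux_quad _ _ _ _ _ hWs _ hyM, hyA] at qy
  have hsym : y ⬝ᵥ (W *ᵥ x) = x ⬝ᵥ (W *ᵥ y) := by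
    rw [Matrix.dotProduct_mulVec, ← Matrix.mulVec_transpose, hWs.eq, dotProduct_comm]
  simp only [sub_dotProduct, add_dotProduct, smul_dotProduct, smul_eq_mul, hsym] at qx qy
  have p1 := mul_nonneg hre.le wx
  have p2 := mul_nonneg hre.le wy
  by_cases hx0 : x = 0
  · have hy0 : y ≠ 0 := by
      intro hy0
      apply hw
      ext i
      exact Complex.ext (congrFun hx0 i) (congrFun hy0 i)
    have := hQ.dotProduct_mulVec_pos hy0
    simp only [star_trivial] at this
    linarith
  · have := hQ.dotProduct_mulVec_pos hx0
    simp only [star_trivial] at this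
    linarith
end

section
/- In the Douglas–Rachford setup below, the sequence (uₖ − vₖ)_{k≥1} converges to 0, and moreover √k · min_{1≤i≤k} ‖uᵢ − vᵢ‖ → 0 as k → ∞ (i.e., min_{i≤k} ‖uᵢ − vᵢ‖ = o(1/√k)). -/
open Filter Topology in
theorem aux_min (x : ℕ → ℝ) (hx : ∀ i, 0 ≤ x i) (hs : Summable fun i => x i ^ 2) :
    Filter.Tendsto
        (fun k : ℕ => Real.sqrt (k + 1)
          * (Finset.Icc 1 (k + 1)).inf'
              ⟨1, Finset.mem_Icc.mpr ⟨le_refl 1, Nat.le_add_left 1 k⟩⟩ x)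
        Filter.atTop (nhds 0) := by
  have hS := hs.hasSum.tendsto_sum_nat
  have h1 : Tendsto (fun k : ℕ => k + 2) atTop atTop := tendsto_add_atTop_nat 2
  have h2 : Tendsto (fun k : ℕ => k / 2 + 1) atTop atTop :=
    (tendsto_add_atTop_nat 1).comp (Nat.tendsto_div_const_atTop (by norm_num))
  have h3 := ((hS.comp h1).sub (hS.comp h2)).const_mul 2
  rw [sub_self, mul_zero] at h3
  have h4 := (Real.continuous_sqrt.tendsto 0).comp h3
  rw [Real.sqrt_zero] at h4
  refine squeeze_zero ?_ ?_ h4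
  · intro k
    refine mul_nonneg (Real.sqrt_nonneg _) ?_
    refine (Finset.le_inf'_iff _ _).2 ?_
    intro i _
    exact hx i
  · intro k
    set m := (Finset.Icc 1 (k + 1)).inf'
              ⟨1, Finset.mem_Icc.mpr ⟨le_refl 1, Nat.le_add_left 1 k⟩⟩ x with hm
    have hm0 : 0 ≤ m := by
      refine (Finset.le_inf'_iff _ _).2 ?_
      intro i _
      exact hx i
    apply Real.le_sqrt_of_sq_le
    rw [mul_pow, Real.sq_sqrt (by positivity)]
    simp only [Function.comp]
    rw [← Finset.sum_Ico_eq_sub _ (by omega : k / 2 + 1 ≤ k + 2)]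
    have h5 : (Finset.Ico (k/2+1) (k+2)).card • m ^ 2 ≤ ∑ i ∈ Finset.Ico (k/2+1) (k+2), x i ^ 2 := by
      apply Finset.card_nsmul_le_sum
      intro i hi
      rw [Finset.mem_Ico] at hi
      apply pow_le_pow_left₀ hm0
      exact Finset.inf'_le _ (Finset.mem_Icc.mpr ⟨by omega, by omega⟩)
    rw [Nat.card_Ico, nsmul_eq_mul] at h5
    have h6 : ((k:ℝ) + 1) ≤ 2 * ((k + 2 - (k/2+1) : ℕ) : ℝ) := by
      have : k + 1 ≤ 2 * (k + 2 - (k/2+1)) := by omega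
      exact_mod_cast this
    nlinarith [sq_nonneg m]

theorem aux_core {d : ℕ} (u v G : ℕ → EuclideanSpace ℝ (Fin d)) (p q : ℕ → ℝ) (L ξ η m₁ m₂ : ℝ)
    (hL : 0 < L) (hξ0 : 0 < ξ) (hξ2 : ξ < 2) (hη0 : 0 < η) (hη1 : η * L < (2 - ξ) / 2)
    (hη2 : η * L < 1) (hp : ∀ n, m₁ ≤ p n) (hq : ∀ n, m₂ ≤ q n)
    (hlip : ∀ n, ‖G (n+1) - G n‖ ≤ L * ‖u (n+1) - u n‖)
    (hlow : ∀ n, p (n+1) + inner ℝ (G (n+1)) (u n - u (n+1)) ≤ p n)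
    (hlow' : ∀ n, p n + inner ℝ (G n) (u (n+1) - u n) ≤ p (n+1))
    (hup : ∀ n, p (n+1) ≤ p n + (inner ℝ (G n) (u (n+1) - u n) + L / 2 * ‖u (n+1) - u n‖^2))
    (hv : ∀ n, q (n+1) + 1 / (2 * η) * ‖v (n+1) - (u (n+1) - η • G (n+1))‖^2
      ≤ q n + 1 / (2 * η) * ‖v n - (u (n+1) - η • G (n+1))‖^2)
    (hs : ∀ n, ξ • (v n - u n) = (u (n+1) - u n) + η • (G (n+1) - G n)) :
    Summable fun n => ‖u n - v n‖^2 := by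
  set A : ℕ → ℝ := fun n => ‖u (n+1) - u n‖^2 with hA
  set B : ℕ → ℝ := fun n => ‖G (n+1) - G n‖^2 with hB
  set I : ℕ → ℝ := fun n => inner ℝ (u (n+1) - u n) (G (n+1) - G n) with hI
  set W : ℕ → ℝ := fun n => ‖v n - u n‖^2 with hW
  set E : ℕ → ℝ := fun n => q n + p n + inner ℝ (G n) (v n - u n) + 1 / (2 * η) * W n with hE
  set V : ℕ → ℝ := fun n => p n + η / 2 * ‖G n‖^2 with hV
  have hA0 : ∀ n, 0 ≤ A n := fun n => sq_nonneg _
  have hB0 : ∀ n, 0 ≤ B n := fun n => sq_nonneg _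
  have hBA : ∀ n, B n ≤ L^2 * A n := by
    intro n
    simp only [hA, hB]
    rw [← mul_pow]
    exact pow_le_pow_left₀ (norm_nonneg _) (hlip n) 2
  have hI0 : ∀ n, 0 ≤ I n := by
    intro n
    have h1 := hlow n
    have h2 := hlow' n
    have : I n = - inner ℝ (G (n+1)) (u n - u (n+1)) - inner ℝ (G n) (u (n+1) - u n) := by
      simp only [hI, inner_sub_left, inner_sub_right, real_inner_comm (G _) (u _)]
      ring
    linarith
  have hWe : ∀ n, ξ^2 * W n = A n + 2 * η * I n + η^2 * B n := by
    intro n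
    have h := congrArg (fun z => ‖z‖^2) (hs n)
    simp only [norm_smul, norm_add_sq_real, inner_smul_right, mul_pow, Real.norm_eq_abs, sq_abs] at h
    simp only [hW, hA, hB, hI]
    rw [h]; ring
  -- decrease
  have hdec : ∀ n, E (n+1) ≤ E n - ((2 - ξ) / 2 - (η * L)^2) / (η * ξ) * A n := by
    intro n
    have h1 := hv n
    have e1 : ‖v (n+1) - (u (n+1) - η • G (n+1))‖^2 =
        W (n+1) + 2 * η * inner ℝ (G (n+1)) (v (n+1) - u (n+1)) + η^2 * ‖G (n+1)‖^2 := by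
      have : v (n+1) - (u (n+1) - η • G (n+1)) = (v (n+1) - u (n+1)) + η • G (n+1) := by abel
      rw [this, norm_add_sq_real, inner_smul_right, norm_smul, mul_pow, Real.norm_eq_abs, sq_abs,
        real_inner_comm]
      simp only [hW]; ring
    have e2 : ‖v n - (u (n+1) - η • G (n+1))‖^2 =
        W n - 2 * inner ℝ (u (n+1) - u n) (v n - u n) + A n
        + 2 * η * inner ℝ (G (n+1)) (v n - u (n+1)) + η^2 * ‖G (n+1)‖^2 := by
      have : v n - (u (n+1) - η • G (n+1)) = (v n - u (n+1)) + η • G (n+1) := by abel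
      rw [this, norm_add_sq_real, inner_smul_right, norm_smul, mul_pow, Real.norm_eq_abs, sq_abs,
        real_inner_comm]
      have : ‖v n - u (n+1)‖^2 = W n - 2 * inner ℝ (u (n+1) - u n) (v n - u n) + A n := by
        have : v n - u (n+1) = (v n - u n) - (u (n+1) - u n) := by abel
        rw [this, norm_sub_sq_real, real_inner_comm]
      rw [this]; ring
    rw [e1, e2] at h1
    have e3 : ξ * inner ℝ (u (n+1) - u n) (v n - u n) = A n + η * I n := by
      rw [← inner_smul_right, hs, inner_add_right, inner_smul_right, real_inner_self_eq_norm_sq]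
    have e4 : ξ * inner ℝ (G (n+1) - G n) (v n - u n) = I n + η * B n := by
      rw [← inner_smul_right, hs, inner_add_right, inner_smul_right, real_inner_self_eq_norm_sq,
        real_inner_comm]
    have e5 : (inner ℝ (G (n+1)) (v n - u (n+1)) : ℝ) = inner ℝ (G (n+1) - G n) (v n - u n)
        + inner ℝ (G n) (v n - u n) + inner ℝ (G (n+1)) (u n - u (n+1)) := by
      simp only [inner_sub_left, inner_sub_right]; ring
    have h2 := hlow n
    have e3' : (inner ℝ (u (n+1) - u n) (v n - u n) : ℝ) = (A n + η * I n) / ξ := by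
      field_simp; linarith
    have e4' : (inner ℝ (G (n+1) - G n) (v n - u n) : ℝ) = (I n + η * B n) / ξ := by
      field_simp; linarith
    rw [e5, e3', e4'] at h1
    have h3 : η / ξ * B n ≤ η / ξ * (L^2 * A n) :=
      mul_le_mul_of_nonneg_left (hBA n) (by positivity)
    have key : E (n+1) ≤ E n + η / ξ * B n - (2 - ξ) / (2 * η * ξ) * A n := by
      simp only [hE]
      have r1 : q (n+1) + (1/(2*η) * W (n+1) + inner ℝ (G (n+1)) (v (n+1) - u (n+1))
          + η/2 * ‖G (n+1)‖^2) ≤ q n + (1/(2*η) * W n - (A n + η * I n) / (ξ * η) + 1/(2*η) * A n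
          + ((I n + η * B n) / ξ + inner ℝ (G n) (v n - u n) + inner ℝ (G (n+1)) (u n - u (n+1)))
          + η/2 * ‖G (n+1)‖^2) := by
        convert h1 using 2
        · field_simp
        · field_simp
      have r2 : η / ξ * B n - (2 - ξ) / (2 * η * ξ) * A n =
        - (A n + η * I n) / (ξ * η) + 1/(2*η) * A n + (I n + η * B n) / ξ := by
        field_simp; ring
      have r3 : - (A n + η * I n) / (ξ * η) = -((A n + η * I n) / (ξ * η)) := by ring
      linarith
    have r4 : ((2 - ξ) / 2 - (η * L)^2) / (η * ξ) * A n
      = (2 - ξ) / (2 * η * ξ) * A n - η / ξ * (L^2 * A n) := by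
      field_simp
    linarith
  set c := ((2 - ξ) / 2 - (η * L)^2) / (η * ξ) with hc
  have hηL : 0 < η * L := by positivity
  have hc0 : 0 < c := by
    apply div_pos _ (by positivity)
    nlinarith
  have hanti : Antitone E := antitone_nat_of_succ_le fun n => by
    have := hdec n
    have := mul_nonneg hc0.le (hA0 n)
    linarith
  -- lower estimate
  have hlb : ∀ n, m₁ + m₂ + (V (n+1) - V n) / ξ ≤ E n := by
    intro n
    have h1 := hup n
    have e1 : ξ * inner ℝ (G n) (v n - u n) =
        inner ℝ (G n) (u (n+1) - u n) + η * inner ℝ (G n) (G (n+1) - G n) := by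
      rw [← inner_smul_right, hs, inner_add_right, inner_smul_right]
    have e2 : ‖G (n+1)‖^2 = ‖G n‖^2 + 2 * inner ℝ (G n) (G (n+1) - G n) + B n := by
      have : G (n+1) = G n + (G (n+1) - G n) := by abel
      conv_lhs => rw [this]
      rw [norm_add_sq_real]
    have h2 : V (n+1) - V n ≤ ξ * inner ℝ (G n) (v n - u n) + L/2 * A n + η/2 * B n := by
      simp only [hV]
      rw [e1, e2]; simp only [hA]; linarith
    have h3 : ξ * (L/2 * A n + η/2 * B n) * (2 * η) ≤ ξ^2 * W n := by
      rw [hWe]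
      have hb : η^2 * B n ≤ (η * L)^2 * A n := by nlinarith [hBA n, sq_nonneg η]
      have hb0 : 0 ≤ η^2 * B n := mul_nonneg (sq_nonneg _) (hB0 n)
      have hi : 0 ≤ 2 * η * I n := mul_nonneg (by positivity) (hI0 n)
      have goal2 : 0 ≤ (1 - η * L * ξ) * A n + (1 - ξ) * (η^2 * B n) := by
        have hA0' := hA0 n
        generalize A n = a at hb hA0' ⊢
        generalize η^2 * B n = b at hb hb0 ⊢
        clear_value A B I W E V
        generalize η * L = l at hb hηL hη1 hη2 ⊢
        have hlq : (1 - l * ξ) ≥ (ξ - 1) * l^2 ∧ 0 ≤ 1 - l * ξ := by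
          have t1 : l * ξ ≤ (2 - ξ)/2 * ξ := by nlinarith
          have t2 : l^2 ≤ (2-ξ)/2 := by nlinarith
          have t3 : 0 ≤ 1 - l * ξ := by nlinarith [sq_nonneg (ξ - 1)]
          refine ⟨?_, t3⟩
          rcases le_total ξ 1 with h | h
          · nlinarith [sq_nonneg l]
          · nlinarith [sq_nonneg (ξ - 1)]
        rcases le_total ξ 1 with h | h
        · have := mul_nonneg hlq.2 (hA0')
          have := mul_nonneg (sub_nonneg.2 h) hb0
          linarith
        · have := mul_le_mul_of_nonneg_left hb (sub_nonneg.2 h)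
          have := mul_le_mul_of_nonneg_right hlq.1 hA0'
          linarith
      nlinarith
    have h4 : (V (n+1) - V n) / ξ ≤ inner ℝ (G n) (v n - u n) + 1 / (2 * η) * W n := by
      rw [div_le_iff₀ hξ0]
      have : L/2 * A n + η/2 * B n ≤ ξ * W n / (2 * η) := by
        rw [le_div_iff₀ (by positivity)]
        have : ξ * ((L/2 * A n + η/2 * B n) * (2 * η)) ≤ ξ * (ξ * W n) := by linarith
        exact le_of_mul_le_mul_left this hξ0
      have e : 1 / (2 * η) * W n * ξ = ξ * W n / (2 * η) := by ring
      linarith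
    simp only [hE]
    linarith [hp n, hq n]
  have hElow : ∀ n, m₁ + m₂ ≤ E n := by
    intro N
    by_contra! hN
    set ε := (m₁ + m₂ - E N) * ξ with hε
    have hε0 : 0 < ε := mul_pos (by linarith) hξ0
    have hstep : ∀ k, V (N + k) ≤ V N - k * ε := by
      intro k
      induction k with
      | zero => simp
      | succ k ih =>
        have h1 := hlb (N + k)
        have h2 := hanti (Nat.le_add_right N k)
        have h3 : (V (N+k+1) - V (N+k)) / ξ ≤ -(m₁ + m₂ - E N) := by linarith
        rw [div_le_iff₀ hξ0] at h3
        rw [← add_assoc]; push_cast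
        linarith
    obtain ⟨k, hk⟩ := exists_nat_gt ((V N - m₁) / ε)
    rw [div_lt_iff₀ hε0] at hk
    have h1 := hstep k
    have h2 : m₁ ≤ V (N + k) := by
      have := hp (N+k)
      have : 0 ≤ η / 2 * ‖G (N+k)‖^2 := by positivity
      simp only [hV]; linarith
    linarith
  have hsumA : Summable A := by
    apply summable_of_sum_range_le (c := (E 0 - (m₁ + m₂)) / c) hA0
    intro n
    rw [le_div_iff₀ hc0]
    have : (∑ i ∈ Finset.range n, A i) * c ≤ E 0 - E n := by
      induction n with
      | zero => simp
      | succ n ih => rw [Finset.sum_range_succ]; linarith [hdec n]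
    linarith [hElow n]
  refine Summable.of_nonneg_of_le (fun n => sq_nonneg _) (fun n => ?_) (hsumA.mul_left ((2 + 2 * (η*L)^2) / ξ^2))
  rw [norm_sub_rev]
  have h1 := hWe n
  have h2 : 2 * η * I n ≤ A n + η^2 * B n := by
    have h := sq_nonneg ‖(u (n+1) - u n) - η • (G (n+1) - G n)‖
    rw [norm_sub_sq_real, inner_smul_right, norm_smul, mul_pow, Real.norm_eq_abs, sq_abs] at h
    simp only [hA, hB, hI]; linarith
  have hb : η^2 * B n ≤ (η * L)^2 * A n := by nlinarith [hBA n, sq_nonneg η]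
  rw [div_mul_eq_mul_div, le_div_iff₀ (by positivity)]
  change W n * ξ^2 ≤ _
  linarith


/-- in the DR setup, `uₖ − vₖ → 0` and
`√k · min_{1 ≤ i ≤ k} ‖uᵢ − vᵢ‖ → 0` (stated with the index shift `k ↦ k + 1` so that the
minimum is over the nonempty range `1 ≤ i ≤ k + 1`). -/
theorem stmt_14 {d : ℕ}
    (φ₁ φ₂ : EuclideanSpace ℝ (Fin d) → EReal)
    -- φ₁ proper, lsc, convex, bounded below
    (hφ₁ne : ∃ x, φ₁ x ≠ ⊤) (hφ₁nb : ∀ x, φ₁ x ≠ ⊥)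
    (hφ₁lsc : LowerSemicontinuous φ₁)
    (hφ₁conv : ∀ (x y : EuclideanSpace ℝ (Fin d)) (a b : ℝ), 0 ≤ a → 0 ≤ b → a + b = 1 →
      φ₁ (a • x + b • y) ≤ (a : EReal) * φ₁ x + (b : EReal) * φ₁ y)
    (hφ₁bdd : ∃ m : ℝ, ∀ x, (m : EReal) ≤ φ₁ x)
    -- L-smoothness of φ₁ on its domain D = dom φ₁, with gradient map G
    (G : EuclideanSpace ℝ (Fin d) → EuclideanSpace ℝ (Fin d)) (L : ℝ) (hL : 0 < L)
    (hGlip : ∀ x y, φ₁ x ≠ ⊤ → φ₁ y ≠ ⊤ → ‖G x - G y‖ ≤ L * ‖x - y‖)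
    (hGlower : ∀ x y, φ₁ x ≠ ⊤ → φ₁ y ≠ ⊤ →
      φ₁ x + ((inner ℝ (G x) (y - x) : ℝ) : EReal) ≤ φ₁ y)
    (hGupper : ∀ x y, φ₁ x ≠ ⊤ → φ₁ y ≠ ⊤ →
      φ₁ y ≤ φ₁ x + ((inner ℝ (G x) (y - x) + L / 2 * ‖y - x‖ ^ 2 : ℝ) : EReal))
    -- φ₂ proper, lsc, bounded below
    (hφ₂ne : ∃ x, φ₂ x ≠ ⊤) (hφ₂nb : ∀ x, φ₂ x ≠ ⊥)
    (hφ₂lsc : LowerSemicontinuous φ₂)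
    (hφ₂bdd : ∃ m : ℝ, ∀ x, (m : EReal) ≤ φ₂ x)
    -- φ = φ₁ + φ₂ proper
    (hφne : ∃ x, φ₁ x + φ₂ x ≠ ⊤)
    -- stepsizes
    (ξ η : ℝ) (hξ0 : 0 < ξ) (hξ2 : ξ < 2)
    (hη0 : 0 < η) (hη1 : η < (2 - ξ) / (2 * L)) (hη2 : η < 1 / L)
    -- DR iterates
    (u v s : ℕ → EuclideanSpace ℝ (Fin d))
    (hu_min : ∀ n, ∀ y, φ₁ (u (n + 1)) + ((1 / (2 * η) * ‖u (n + 1) - s n‖ ^ 2 : ℝ) : EReal)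
      ≤ φ₁ y + ((1 / (2 * η) * ‖y - s n‖ ^ 2 : ℝ) : EReal))
    (hu_unique : ∀ n, ∀ y,
      (∀ z, φ₁ y + ((1 / (2 * η) * ‖y - s n‖ ^ 2 : ℝ) : EReal)
        ≤ φ₁ z + ((1 / (2 * η) * ‖z - s n‖ ^ 2 : ℝ) : EReal)) → y = u (n + 1))
    (hu_grad : ∀ n, s n = u (n + 1) + η • G (u (n + 1)))
    (hv_min : ∀ n, ∀ y,
      φ₂ (v (n + 1))
          + ((1 / (2 * η) * ‖v (n + 1) - ((2 : ℝ) • u (n + 1) - s n)‖ ^ 2 : ℝ) : EReal)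
        ≤ φ₂ y + ((1 / (2 * η) * ‖y - ((2 : ℝ) • u (n + 1) - s n)‖ ^ 2 : ℝ) : EReal))
    (hs_update : ∀ n, s (n + 1) = s n + ξ • (v (n + 1) - u (n + 1))) :
    Filter.Tendsto (fun k : ℕ => u k - v k) Filter.atTop (nhds 0)
    ∧ Filter.Tendsto
        (fun k : ℕ => Real.sqrt (k + 1)
          * (Finset.Icc 1 (k + 1)).inf'
              ⟨1, Finset.mem_Icc.mpr ⟨le_refl 1, Nat.le_add_left 1 k⟩⟩
              (fun i => ‖u i - v i‖))
        Filter.atTop (nhds 0) := by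
  obtain ⟨x₁, hx₁⟩ := hφ₁ne
  obtain ⟨x₂, hx₂⟩ := hφ₂ne
  obtain ⟨m₁, hm₁⟩ := hφ₁bdd
  obtain ⟨m₂, hm₂⟩ := hφ₂bdd
  have hut : ∀ n, φ₁ (u (n+1)) ≠ ⊤ := by
    intro n h
    have h1 := hu_min n x₁
    rw [h, EReal.top_add_coe, top_le_iff] at h1
    exact EReal.add_ne_top hx₁ (EReal.coe_ne_top _) h1
  have hvt : ∀ n, φ₂ (v (n+1)) ≠ ⊤ := by
    intro n h
    have h1 := hv_min n x₂
    rw [h, EReal.top_add_coe, top_le_iff] at h1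
    exact EReal.add_ne_top hx₂ (EReal.coe_ne_top _) h1
  have hpe : ∀ n, φ₁ (u (n+1)) = (((φ₁ (u (n+1))).toReal : ℝ) : EReal) := fun n =>
    (EReal.coe_toReal (hut n) (hφ₁nb _)).symm
  have hqe : ∀ n, φ₂ (v (n+1)) = (((φ₂ (v (n+1))).toReal : ℝ) : EReal) := fun n =>
    (EReal.coe_toReal (hvt n) (hφ₂nb _)).symm
  have hsum : Summable fun n => ‖u (n+1) - v (n+1)‖^2 := by
    refine aux_core (fun n => u (n+1)) (fun n => v (n+1)) (fun n => G (u (n+1)))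
      (fun n => (φ₁ (u (n+1))).toReal) (fun n => (φ₂ (v (n+1))).toReal) L ξ η m₁ m₂ hL hξ0 hξ2 hη0
      ?_ ?_ ?_ ?_ ?_ ?_ ?_ ?_ ?_ ?_
    · rw [lt_div_iff₀ (by positivity)] at hη1; linarith
    · rw [lt_div_iff₀ hL] at hη2; exact hη2
    · intro n
      have := hm₁ (u (n+1))
      rw [hpe n] at this
      exact_mod_cast this
    · intro n
      have := hm₂ (v (n+1))
      rw [hqe n] at this
      exact_mod_cast this
    · intro n
      exact hGlip _ _ (hut _) (hut _)
    · intro n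
      have := hGlower _ _ (hut (n+1)) (hut n)
      rw [hpe n, hpe (n+1)] at this
      exact_mod_cast this
    · intro n
      have := hGlower _ _ (hut n) (hut (n+1))
      rw [hpe n, hpe (n+1)] at this
      exact_mod_cast this
    · intro n
      have := hGupper _ _ (hut n) (hut (n+1))
      rw [hpe n, hpe (n+1)] at this
      exact_mod_cast this
    · intro n
      have h := hv_min (n+1) (v (n+1))
      have e : (2 : ℝ) • u (n + 1 + 1) - s (n+1) = u (n+1+1) - η • G (u (n+1+1)) := by
        rw [hu_grad (n+1), two_smul]; abel
      rw [e, hqe n, hqe (n+1)] at h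
      exact_mod_cast h
    · intro n
      have h := hs_update n
      rw [hu_grad n, hu_grad (n+1)] at h
      have h2 : ξ • (v (n+1) - u (n+1)) = (u (n+1+1) + η • G (u (n+1+1)))
        - (u (n+1) + η • G (u (n+1))) := by rw [h]; abel
      rw [h2, smul_sub]; abel
  have hsum' : Summable fun n => ‖u n - v n‖^2 := (summable_nat_add_iff 1).mp hsum
  refine ⟨?_, aux_min _ (fun i => norm_nonneg _) hsum'⟩
  rw [tendsto_zero_iff_norm_tendsto_zero]
  have h := (Real.continuous_sqrt.tendsto 0).comp hsum'.tendsto_atTop_zero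
  rw [Real.sqrt_zero] at h
  refine h.congr fun n => ?_
  simp [Real.sqrt_sq]
end

section
/- In the Douglas–Rachford setup below, assume additionally that D = dom(φ₁) is closed. Then the sequences (uₖ)_{k≥1} and (vₖ)_{k≥1} have the same set of cluster points, and every cluster point u′ of (uₖ) satisfies the first-order optimality condition 0 ∈ ∂̂(φ₁ + φ₂)(u′), where ∂̂ denotes the Fréchet subdifferential. -/
/-- The set of cluster points of a sequence: limits of convergent subsequences. -/
def clusterPts {α : Type*} [TopologicalSpace α] (w : ℕ → α) : Set α :=
  {x | ∃ φ : ℕ → ℕ, StrictMono φ ∧ Filter.Tendsto (fun n => w (φ n)) Filter.atTop (nhds x)}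

/-- Fréchet subdifferential of `ψ` at a point `x` where `ψ x` is finite:
`d ∈ ∂̂ψ(x)` iff `liminf_{y → x, y ≠ x} (ψ(y) − ψ(x) − ⟨d, y − x⟩)/‖y − x‖ ≥ 0`. -/
noncomputable def frechetSubdiff {d : ℕ} (ψ : EuclideanSpace ℝ (Fin d) → EReal)
    (x : EuclideanSpace ℝ (Fin d)) : Set (EuclideanSpace ℝ (Fin d)) :=
  {v | ψ x ≠ ⊤ ∧ ψ x ≠ ⊥ ∧
    (0 : EReal) ≤ Filter.liminf
      (fun y => (ψ y - ψ x - ((inner ℝ v (y - x) : ℝ) : EReal)) / ((‖y - x‖ : ℝ) : EReal))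
      (nhdsWithin x {x}ᶜ)}

open Filter Topology

theorem aux_dr {V : Type*} [NormedAddCommGroup V] [InnerProductSpace ℝ V]
    (u v g : ℕ → V) (f c : ℕ → ℝ) (m1 m2 L ξ η : ℝ) (hL : 0 < L)
    (hξ0 : 0 < ξ) (hξ2 : ξ < 2) (hη0 : 0 < η) (ha1 : η * L < (2 - ξ) / 2) (ha2 : η * L < 1)
    (hm1 : ∀ n, m1 ≤ f n) (hm2 : ∀ n, m2 ≤ c n)
    (lip : ∀ n, ‖g (n+1) - g n‖ ≤ L * ‖u (n+1) - u n‖)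
    (low : ∀ i j, f i + inner ℝ (g i) (u j - u i) ≤ f j)
    (upp : ∀ i j, f j ≤ f i + (inner ℝ (g i) (u j - u i) + L / 2 * ‖u j - u i‖ ^ 2))
    (vmin : ∀ n, c (n+1) + 1 / (2 * η) * ‖v (n+1) - (u (n+1) - η • g (n+1))‖ ^ 2
      ≤ c n + 1 / (2 * η) * ‖v n - (u (n+1) - η • g (n+1))‖ ^ 2)
    (upd : ∀ n, u (n+1) + η • g (n+1) = u n + η • g n + ξ • (v n - u n)) :
    Tendsto (fun n => v n - u n) atTop (𝓝 0) := by
  set E : ℕ → ℝ := fun n => f n + inner ℝ (g n) (v n - u n) + c n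
    + 1 / (2 * η) * ‖v n - u n‖ ^ 2 with hE
  set H : ℕ → ℝ := fun n => f n + η / 2 * ‖g n‖ ^ 2 with hH
  set κ : ℝ := ((2 - ξ) / 2 - (η * L) ^ 2) / (η * ξ) with hκ
  have ha0 : 0 < η * L := by positivity
  have haa : (η * L) ^ 2 < (2 - ξ) / 2 := by nlinarith
  have hκ0 : 0 < κ := by
    apply div_pos <;> [linarith; positivity]
  have hw : ∀ n, v n - u n = (1 / ξ) • ((u (n+1) - u n) + η • (g (n+1) - g n)) := by
    intro n
    have h1 : ξ • (v n - u n) = (u (n+1) - u n) + η • (g (n+1) - g n) := by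
      have := upd n
      rw [smul_sub η]
      have h2 : ξ • (v n - u n) = u (n+1) + η • g (n+1) - (u n + η • g n) := by
        rw [this]; abel
      rw [h2]; abel
    rw [← h1, smul_smul]
    field_simp
    simp
  have hQ : ∀ n, ‖g (n+1) - g n‖ ^ 2 ≤ L ^ 2 * ‖u (n+1) - u n‖ ^ 2 := by
    intro n
    rw [← mul_pow]
    exact pow_le_pow_left₀ (norm_nonneg _) (lip n) 2
  -- descent
  have hdesc : ∀ n, E (n+1) ≤ E n - κ * ‖u (n+1) - u n‖ ^ 2 := by
    intro n
    have hv := vmin n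
    have hl := low (n+1) n
    have hq := hQ n
    have hwn := hw n
    simp only [hE]
    set p := u (n+1) - u n with hp
    set q := g (n+1) - g n with hq'
    set w := v n - u n with hw'
    have e1 : v (n+1) - (u (n+1) - η • g (n+1)) = (v (n+1) - u (n+1)) + η • g (n+1) := by abel
    have e2 : v n - (u (n+1) - η • g (n+1)) = (w - p) + η • g (n+1) := by
      rw [hw', hp]; abel
    have e3 : u n - u (n+1) = - p := by rw [hp]; abel
    have e4 : g n = g (n+1) - q := by rw [hq']; abel
    rw [e1, e2, norm_add_sq_real, norm_add_sq_real (w - p), norm_sub_sq_real w p] at hv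
    rw [e3, inner_neg_right] at hl
    rw [e4]
    rw [inner_smul_right, inner_smul_right, real_inner_comm, real_inner_comm _ (w - p),
      inner_sub_right _ w p] at hv
    rw [inner_sub_left]
    have iq : inner ℝ q w = (1 / ξ) * (inner ℝ p q + η * ‖q‖ ^ 2) := by
      rw [hwn, inner_smul_right, inner_add_right, inner_smul_right, real_inner_self_eq_norm_sq,
        real_inner_comm]
    have ip : inner ℝ w p = (1 / ξ) * (‖p‖ ^ 2 + η * inner ℝ p q) := by
      rw [hwn, inner_smul_left, inner_add_left, inner_smul_left, real_inner_self_eq_norm_sq,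
        real_inner_comm p q]
      simp
    rw [iq]
    rw [ip] at hv
    generalize inner ℝ p q = R at *
    generalize inner ℝ (g (n+1)) w = A at *
    generalize inner ℝ (g (n+1)) p = B at *
    generalize inner ℝ (g (n+1)) (v (n+1) - u (n+1)) = C at *
    generalize ‖v (n+1) - u (n+1)‖ ^ 2 = W' at *
    generalize ‖w‖ ^ 2 = W at *
    generalize ‖p‖ ^ 2 = P at *
    generalize ‖q‖ ^ 2 = Q at *
    generalize ‖η • g (n+1)‖ ^ 2 = Z at *
    have hv2 : c (n+1) + (1 / (2 * η) * W' + C) ≤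
        c n + (1 / (2 * η) * W + A - B + (1/(2*η) * P - 1 / (η * ξ) * P - R / ξ)) := by
      have t1 : c (n+1) + 1 / (2 * η) * (W' + 2 * (η * C) + Z) =
        c (n+1) + (1 / (2 * η) * W' + C) + 1 / (2 * η) * Z := by field_simp; ring
      have t2 : c n + 1 / (2 * η) * (W - 2 * (1 / ξ * (P + η * R)) + P + 2 * (η * (A - B)) + Z) =
        c n + (1 / (2 * η) * W + A - B + (1/(2*η) * P - 1 / (η * ξ) * P - R / ξ))
          + 1 / (2 * η) * Z := by field_simp; ring
      linarith
    have t3 : 1/(2*η) * P - 1 / (η * ξ) * P + η / ξ * (L ^ 2 * P) = - (κ * P) := by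
      rw [hκ]; field_simp; ring
    have t4 : η / ξ * Q ≤ η / ξ * (L ^ 2 * P) := by
      apply mul_le_mul_of_nonneg_left hq; positivity
    have t5 : 1 / ξ * (R + η * Q) = R / ξ + η / ξ * Q := by field_simp
    linarith
  -- lower estimate
  have hlowE : ∀ n, m1 + m2 + (1 / ξ) * (H (n+1) - H n) ≤ E n := by
    intro n
    have hl := low n (n+1)
    have hl' := low (n+1) n
    have hu := upp n (n+1)
    have hq := hQ n
    have hwn := hw n
    have h1 := hm1 n
    have h2 := hm2 n
    simp only [hE, hH]
    set p := u (n+1) - u n with hp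
    set q := g (n+1) - g n with hq'
    have e3 : u n - u (n+1) = - p := by rw [hp]; abel
    have e4 : g (n+1) = g n + q := by rw [hq']; abel
    rw [e3, inner_neg_right, e4, inner_add_left, real_inner_comm p q] at hl'
    rw [e4, norm_add_sq_real, hwn, inner_smul_right, norm_smul, mul_pow, norm_add_sq_real p,
      inner_add_right, inner_smul_right, inner_smul_right, norm_smul, mul_pow]
    rw [Real.norm_eq_abs, Real.norm_eq_abs, sq_abs, sq_abs]
    have hP0 : 0 ≤ ‖p‖ ^ 2 := by positivity
    have hQ0 : 0 ≤ ‖q‖ ^ 2 := by positivity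
    rw [real_inner_comm q p] at *
    have hR : 0 ≤ inner ℝ q p := by linarith
    generalize inner ℝ q p = R at *
    generalize inner ℝ (g n) p = A at *
    generalize inner ℝ (g n) q = B at *
    generalize ‖p‖ ^ 2 = P at *
    generalize ‖q‖ ^ 2 = Q at *
    generalize ‖g n‖ ^ 2 = Z at *
    have key : 0 ≤ - (L * η * ξ * P) - η ^ 2 * ξ * Q + (P + 2 * η * R + η ^ 2 * Q) := by
      have hηR : 0 ≤ η * R := by positivity
      have hQa : η ^ 2 * Q ≤ (η * L) ^ 2 * P := by
        have := mul_le_mul_of_nonneg_left hq (sq_nonneg η)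
        linarith
      have hQb : 0 ≤ η ^ 2 * Q := by positivity
      have : 0 ≤ P * (1 - (η * L) * ξ) - (ξ - 1) * (η ^ 2 * Q) := by
        rcases le_or_gt ξ 1 with h | h
        · have : 0 ≤ P * (1 - (η * L) * ξ) := mul_nonneg hP0 (by nlinarith)
          nlinarith
        · have s1 : (ξ - 1) * (η ^ 2 * Q) ≤ (ξ - 1) * ((η * L) ^ 2 * P) :=
            mul_le_mul_of_nonneg_left hQa (by linarith)
          have s2 : 0 ≤ 1 - (η * L) * ξ - (ξ - 1) * (η * L) ^ 2 := by
            generalize η * L = a at *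
            have hx : ξ < 2 * (1 - a) := by linarith
            have : 0 < a + a ^ 2 := by positivity
            have h6 : ξ * (a + a ^ 2) ≤ 2 * (1 - a) * (a + a ^ 2) :=
              mul_le_mul_of_nonneg_right hx.le this.le
            have h7 : 0 ≤ a ^ 3 := by positivity
            nlinarith [sq_nonneg (1 - a)]
          have := mul_nonneg hP0 s2
          nlinarith
      nlinarith
    have key2 : 0 ≤ 1 / (2 * η * ξ ^ 2) *
      (- (L * η * ξ * P) - η ^ 2 * ξ * Q + (P + 2 * η * R + η ^ 2 * Q)) :=
        mul_nonneg (by positivity) key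
    have hu2 : (1 / ξ) * f (n+1) ≤ (1 / ξ) * (f n + (A + L / 2 * P)) :=
      mul_le_mul_of_nonneg_left hu (by positivity)
    have id : f n + 1 / ξ * (A + η * B) + c n + 1 / (2 * η) * ((1 / ξ) ^ 2 * (P + 2 * (η * R) + η ^ 2 * Q))
      - (f n + c n + 1 / ξ * (f n + (A + L / 2 * P) + η / 2 * (Z + 2 * B + Q) - (f n + η / 2 * Z)))
      = 1 / (2 * η * ξ ^ 2) *
      (- (L * η * ξ * P) - η ^ 2 * ξ * Q + (P + 2 * η * R + η ^ 2 * Q)) := by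
      field_simp; ring
    linarith
  have hanti : Antitone E := antitone_nat_of_succ_le (fun n => by
    have := hdesc n
    have : 0 ≤ κ * ‖u (n+1) - u n‖ ^ 2 := by positivity
    linarith)
  have hElow : ∀ N, m1 + m2 ≤ E N := by
    intro N
    by_contra hlt
    push Not at hlt
    set δ := m1 + m2 - E N with hδ
    have hδ0 : 0 < δ := by linarith
    have hstep : ∀ k : ℕ, H (N + k) ≤ H N - k * (ξ * δ) := by
      intro k
      induction k with
      | zero => simp
      | succ k ih =>
        have h1 := hlowE (N + k)
        have h2 : E (N + k) ≤ E N := hanti (by omega)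
        have h3 : (1 / ξ) * (H (N + k + 1) - H (N + k)) ≤ -δ := by linarith
        have h4 : H (N + k + 1) - H (N + k) ≤ ξ * -δ := by
          have := mul_le_mul_of_nonneg_left h3 hξ0.le
          rw [← mul_assoc] at this
          field_simp at this
          linarith
        rw [← add_assoc]; push_cast; linarith
    obtain ⟨k, hk⟩ := exists_nat_gt ((H N - m1) / (ξ * δ))
    rw [div_lt_iff₀ (by positivity)] at hk
    have h5 := hstep k
    have h6 : m1 ≤ H (N + k) := by
      have := hm1 (N + k)
      have : 0 ≤ η / 2 * ‖g (N + k)‖ ^ 2 := by positivity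
      simp only [hH]; linarith
    linarith
  have hEt : Tendsto E atTop (𝓝 (⨅ i, E i)) :=
    tendsto_atTop_ciInf hanti ⟨m1 + m2, by rintro _ ⟨n, rfl⟩; exact hElow n⟩
  have hdiff : Tendsto (fun n => (E n - E (n+1)) / κ) atTop (𝓝 0) := by
    have := (hEt.sub ((tendsto_add_atTop_iff_nat 1).2 hEt)).div_const κ
    simpa using this
  have hp2 : Tendsto (fun n => ‖u (n+1) - u n‖ ^ 2) atTop (𝓝 0) := by
    refine squeeze_zero (fun n => by positivity) (fun n => ?_) hdiff
    rw [le_div_iff₀ hκ0]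
    have := hdesc n
    linarith
  have hp : Tendsto (fun n => ‖u (n+1) - u n‖) atTop (𝓝 0) := by
    have := hp2.sqrt
    simpa [Real.sqrt_sq] using this
  have hq : Tendsto (fun n => ‖g (n+1) - g n‖) atTop (𝓝 0) :=
    squeeze_zero (fun n => norm_nonneg _) lip (by simpa using hp.const_mul L)
  have hp' := tendsto_zero_iff_norm_tendsto_zero.2 hp
  have hq' := tendsto_zero_iff_norm_tendsto_zero.2 hq
  have := (hp'.add (hq'.const_smul η)).const_smul (1 / ξ)
  simp only [smul_zero, add_zero] at this
  exact this.congr (fun n => (hw n).symm)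

theorem aux_ne_top {a b : EReal} {r t : ℝ} (h : a + (r : EReal) ≤ b + (t : EReal))
    (hb : b ≠ ⊤) : a ≠ ⊤ := by
  rintro rfl
  rw [EReal.top_add_coe, top_le_iff] at h
  exact (EReal.add_lt_top hb (EReal.coe_ne_top t)).ne h

/-- in the DR setup, if additionally `dom φ₁` is closed, then `(uₖ)` and
`(vₖ)` have the same cluster points and every cluster point `u′` of `(uₖ)` satisfies
`0 ∈ ∂̂(φ₁ + φ₂)(u′)`. -/
theorem stmt_15 {d : ℕ}
    (φ₁ φ₂ : EuclideanSpace ℝ (Fin d) → EReal)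
    -- φ₁ proper, lsc, convex, bounded below
    (hφ₁ne : ∃ x, φ₁ x ≠ ⊤) (hφ₁nb : ∀ x, φ₁ x ≠ ⊥)
    (hφ₁lsc : LowerSemicontinuous φ₁)
    (hφ₁conv : ∀ (x y : EuclideanSpace ℝ (Fin d)) (a b : ℝ), 0 ≤ a → 0 ≤ b → a + b = 1 →
      φ₁ (a • x + b • y) ≤ (a : EReal) * φ₁ x + (b : EReal) * φ₁ y)
    (hφ₁bdd : ∃ m : ℝ, ∀ x, (m : EReal) ≤ φ₁ x)
    -- dom φ₁ is closed
    (hdom : IsClosed {x | φ₁ x ≠ ⊤})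
    -- L-smoothness of φ₁ on its domain D = dom φ₁, with gradient map G
    (G : EuclideanSpace ℝ (Fin d) → EuclideanSpace ℝ (Fin d)) (L : ℝ) (hL : 0 < L)
    (hGlip : ∀ x y, φ₁ x ≠ ⊤ → φ₁ y ≠ ⊤ → ‖G x - G y‖ ≤ L * ‖x - y‖)
    (hGlower : ∀ x y, φ₁ x ≠ ⊤ → φ₁ y ≠ ⊤ →
      φ₁ x + ((inner ℝ (G x) (y - x) : ℝ) : EReal) ≤ φ₁ y)
    (hGupper : ∀ x y, φ₁ x ≠ ⊤ → φ₁ y ≠ ⊤ →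
      φ₁ y ≤ φ₁ x + ((inner ℝ (G x) (y - x) + L / 2 * ‖y - x‖ ^ 2 : ℝ) : EReal))
    -- φ₂ proper, lsc, bounded below
    (hφ₂ne : ∃ x, φ₂ x ≠ ⊤) (hφ₂nb : ∀ x, φ₂ x ≠ ⊥)
    (hφ₂lsc : LowerSemicontinuous φ₂)
    (hφ₂bdd : ∃ m : ℝ, ∀ x, (m : EReal) ≤ φ₂ x)
    -- φ = φ₁ + φ₂ proper
    (hφne : ∃ x, φ₁ x + φ₂ x ≠ ⊤)
    -- stepsizes
    (ξ η : ℝ) (hξ0 : 0 < ξ) (hξ2 : ξ < 2)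
    (hη0 : 0 < η) (hη1 : η < (2 - ξ) / (2 * L)) (hη2 : η < 1 / L)
    -- DR iterates
    (u v s : ℕ → EuclideanSpace ℝ (Fin d))
    (hu_min : ∀ n, ∀ y, φ₁ (u (n + 1)) + ((1 / (2 * η) * ‖u (n + 1) - s n‖ ^ 2 : ℝ) : EReal)
      ≤ φ₁ y + ((1 / (2 * η) * ‖y - s n‖ ^ 2 : ℝ) : EReal))
    (hu_unique : ∀ n, ∀ y,
      (∀ z, φ₁ y + ((1 / (2 * η) * ‖y - s n‖ ^ 2 : ℝ) : EReal)
        ≤ φ₁ z + ((1 / (2 * η) * ‖z - s n‖ ^ 2 : ℝ) : EReal)) → y = u (n + 1))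
    (hu_grad : ∀ n, s n = u (n + 1) + η • G (u (n + 1)))
    (hv_min : ∀ n, ∀ y,
      φ₂ (v (n + 1))
          + ((1 / (2 * η) * ‖v (n + 1) - ((2 : ℝ) • u (n + 1) - s n)‖ ^ 2 : ℝ) : EReal)
        ≤ φ₂ y + ((1 / (2 * η) * ‖y - ((2 : ℝ) • u (n + 1) - s n)‖ ^ 2 : ℝ) : EReal))
    (hs_update : ∀ n, s (n + 1) = s n + ξ • (v (n + 1) - u (n + 1))) :
    clusterPts u = clusterPts v
    ∧ ∀ u' ∈ clusterPts u,
        (0 : EuclideanSpace ℝ (Fin d)) ∈ frechetSubdiff (fun z => φ₁ z + φ₂ z) u' := by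
  classical
  obtain ⟨x₁, hx₁⟩ := hφ₁ne
  obtain ⟨x₂, hx₂⟩ := hφ₂ne
  obtain ⟨m1, hm1⟩ := hφ₁bdd
  obtain ⟨m2, hm2⟩ := hφ₂bdd
  have hU : ∀ n, φ₁ (u (n+1)) ≠ ⊤ := fun n => aux_ne_top (hu_min n x₁) hx₁
  have hV : ∀ n, φ₂ (v (n+1)) ≠ ⊤ := fun n => aux_ne_top (hv_min n x₂) hx₂
  have c1 : ∀ x, φ₁ x ≠ ⊤ → φ₁ x = (((φ₁ x).toReal : ℝ) : EReal) :=
    fun x hx => (EReal.coe_toReal hx (hφ₁nb x)).symm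
  have c2 : ∀ x, φ₂ x ≠ ⊤ → φ₂ x = (((φ₂ x).toReal : ℝ) : EReal) :=
    fun x hx => (EReal.coe_toReal hx (hφ₂nb x)).symm
  have hz : ∀ n, (2 : ℝ) • u (n+1) - s n = u (n+1) - η • G (u (n+1)) := by
    intro n
    rw [hu_grad n, two_smul]; abel
  have hηL : η * L < 1 := by rwa [lt_div_iff₀ hL] at hη2
  have hηL' : η * L < (2 - ξ) / 2 := by
    rw [lt_div_iff₀ (by positivity)] at hη1; linarith
  have hvm : ∀ n y, φ₂ y ≠ ⊤ →
      (φ₂ (v (n+1))).toReal + 1 / (2 * η) * ‖v (n+1) - (u (n+1) - η • G (u (n+1)))‖ ^ 2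
      ≤ (φ₂ y).toReal + 1 / (2 * η) * ‖y - (u (n+1) - η • G (u (n+1)))‖ ^ 2 := by
    intro n y hy
    have h := hv_min n y
    rw [hz, c2 _ (hV n), c2 y hy] at h
    exact_mod_cast h
  have key : Tendsto (fun n => v (n+1) - u (n+1)) atTop (𝓝 0) := by
    refine aux_dr (fun n => u (n+1)) (fun n => v (n+1)) (fun n => G (u (n+1)))
      (fun n => (φ₁ (u (n+1))).toReal) (fun n => (φ₂ (v (n+1))).toReal) m1 m2 L ξ η hL hξ0 hξ2
      hη0 hηL' hηL ?_ ?_ ?_ ?_ ?_ ?_ ?_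
    · intro n
      have h := hm1 (u (n+1))
      rw [c1 _ (hU n)] at h
      exact_mod_cast h
    · intro n
      have h := hm2 (v (n+1))
      rw [c2 _ (hV n)] at h
      exact_mod_cast h
    · intro n
      exact hGlip _ _ (hU _) (hU _)
    · intro i j
      have h := hGlower _ _ (hU i) (hU j)
      rw [c1 _ (hU i), c1 _ (hU j)] at h
      exact_mod_cast h
    · intro i j
      have h := hGupper _ _ (hU i) (hU j)
      rw [c1 _ (hU i), c1 _ (hU j)] at h
      exact_mod_cast h
    · intro n
      exact hvm (n+1) (v (n+1)) (hV n)
    · intro n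
      have h := hs_update n
      rw [hu_grad n, hu_grad (n+1)] at h
      exact h
  have key' : Tendsto (fun n => v n - u n) atTop (𝓝 0) :=
    (tendsto_add_atTop_iff_nat 1).1 key
  refine ⟨?_, ?_⟩
  · ext x
    constructor
    · rintro ⟨σ, hσ, hx⟩
      refine ⟨σ, hσ, ?_⟩
      have := hx.add (key'.comp hσ.tendsto_atTop)
      simpa using this
    · rintro ⟨σ, hσ, hx⟩
      refine ⟨σ, hσ, ?_⟩
      have := hx.sub (key'.comp hσ.tendsto_atTop)
      simpa using this
  · rintro x ⟨σ, hσ, hx⟩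
    have hxv : Tendsto (fun n => v (σ n)) atTop (𝓝 x) := by
      have := hx.add (key'.comp hσ.tendsto_atTop)
      simpa using this
    have hev : ∀ᶠ n in atTop, 1 ≤ σ n := hσ.tendsto_atTop.eventually (eventually_ge_atTop 1)
    have hU1 : ∀ k, 1 ≤ k → φ₁ (u k) ≠ ⊤ := by
      intro k hk
      obtain ⟨j, rfl⟩ : ∃ j, k = j + 1 := ⟨k - 1, by omega⟩
      exact hU j
    have hxD : φ₁ x ≠ ⊤ := hdom.mem_of_tendsto hx (hev.mono fun n hn => hU1 _ hn)
    have hGt : Tendsto (fun n => G (u (σ n))) atTop (𝓝 (G x)) := by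
      rw [tendsto_iff_norm_sub_tendsto_zero]
      have h0 : Tendsto (fun n => L * ‖u (σ n) - x‖) atTop (𝓝 0) := by
        simpa using (tendsto_iff_norm_sub_tendsto_zero.1 hx).const_mul L
      exact squeeze_zero' (Eventually.of_forall fun n => norm_nonneg _)
        (hev.mono fun n hn => hGlip _ _ (hU1 _ hn) hxD) h0
    have hZt : Tendsto (fun n => u (σ n) - η • G (u (σ n))) atTop (𝓝 (x - η • G x)) :=
      hx.sub (hGt.const_smul η)
    have hmin : ∀ y, φ₂ y ≠ ⊤ → φ₂ x ≤ (((φ₂ y).toReal + (inner ℝ (G x) (y - x)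
        + 1 / (2 * η) * ‖y - x‖ ^ 2) : ℝ) : EReal) := by
      intro y hy
      have hlim : Tendsto (fun n => (φ₂ y).toReal
          + 1 / (2 * η) * ‖y - (u (σ n) - η • G (u (σ n)))‖ ^ 2
          - 1 / (2 * η) * ‖v (σ n) - (u (σ n) - η • G (u (σ n)))‖ ^ 2) atTop
          (𝓝 ((φ₂ y).toReal + 1 / (2 * η) * ‖y - (x - η • G x)‖ ^ 2
          - 1 / (2 * η) * ‖x - (x - η • G x)‖ ^ 2)) :=
        (((((tendsto_const_nhds.sub hZt).norm.pow 2).const_mul _).const_add _).sub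
          (((hxv.sub hZt).norm.pow 2).const_mul _))
      have heq : (φ₂ y).toReal + 1 / (2 * η) * ‖y - (x - η • G x)‖ ^ 2
          - 1 / (2 * η) * ‖x - (x - η • G x)‖ ^ 2 = (φ₂ y).toReal + (inner ℝ (G x) (y - x)
        + 1 / (2 * η) * ‖y - x‖ ^ 2) := by
        have e1 : y - (x - η • G x) = (y - x) + η • G x := by abel
        have e2 : x - (x - η • G x) = η • G x := by abel
        rw [e1, e2, norm_add_sq_real, inner_smul_right, real_inner_comm]
        field_simp
        ring
      rw [heq] at hlim
      have hlim' := (continuous_coe_real_ereal.tendsto _).comp hlim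
      refine le_of_forall_lt_imp_le_of_dense fun b hb => ?_
      have hb' := hxv.eventually (hφ₂lsc x b hb)
      refine ge_of_tendsto hlim' ?_
      filter_upwards [hb', hev] with n h1 h2
      refine h1.le.trans ?_
      obtain ⟨j, hj⟩ : ∃ j, σ n = j + 1 := ⟨σ n - 1, by omega⟩
      simp only [Function.comp]
      rw [hj, c2 _ (hV j)]
      have := hvm j y hy
      rw [EReal.coe_le_coe_iff]
      linarith
    have hx2 : φ₂ x ≠ ⊤ := ne_top_of_le_ne_top (EReal.coe_ne_top _) (hmin x₂ hx₂)
    have hxs : φ₁ x + φ₂ x = (((φ₁ x).toReal + (φ₂ x).toReal : ℝ) : EReal) := by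
      rw [EReal.coe_add, ← c1 x hxD, ← c2 x hx2]
    refine ⟨?_, ?_, ?_⟩
    · simp only [hxs]; exact EReal.coe_ne_top _
    · simp only [hxs]; exact EReal.coe_ne_bot _
    · rcases eq_or_neBot (𝓝[≠] x) with hb | hb
      · rw [hb]; simp
      have ht : Tendsto (fun y => ((-(1 / (2 * η) * ‖y - x‖) : ℝ) : EReal)) (𝓝[≠] x)
          (𝓝 ((0 : ℝ) : EReal)) := by
        refine (continuous_coe_real_ereal.tendsto _).comp ?_
        have : Continuous fun y : EuclideanSpace ℝ (Fin d) => -(1 / (2 * η) * ‖y - x‖) := by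
          fun_prop
        have h := this.tendsto x
        simp only [sub_self, norm_zero, mul_zero, neg_zero] at h
        exact h.mono_left nhdsWithin_le_nhds
      have h0 := ht.liminf_eq
      rw [EReal.coe_zero] at h0
      rw [← h0]
      refine liminf_le_liminf ?_
      filter_upwards [self_mem_nhdsWithin] with y hy
      have hyx : 0 < ‖y - x‖ := norm_pos_iff.2 (sub_ne_zero.2 hy)
      rw [EReal.le_div_iff_mul_le (by exact_mod_cast hyx) (EReal.coe_ne_top _), hxs,
        inner_zero_left]
      by_cases hy1 : φ₁ y = ⊤
      · rw [hy1, EReal.top_add_of_ne_bot (hφ₂nb y), EReal.top_sub_coe, EReal.top_sub_coe]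
        exact le_top
      by_cases hy2 : φ₂ y = ⊤
      · rw [hy2, EReal.add_top_of_ne_bot (hφ₁nb y), EReal.top_sub_coe, EReal.top_sub_coe]
        exact le_top
      have h1 := hGlower x y hxD hy1
      have h2 := hmin y hy2
      rw [c1 x hxD, c1 y hy1] at h1
      rw [c2 x hx2] at h2
      rw [c1 y hy1, c2 y hy2]
      have h1' : (φ₁ x).toReal + inner ℝ (G x) (y - x) ≤ (φ₁ y).toReal := by exact_mod_cast h1
      have h2' := EReal.coe_le_coe_iff.1 h2
      have h3 : -(1 / (2 * η) * ‖y - x‖) * ‖y - x‖ ≤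
        (φ₁ y).toReal + (φ₂ y).toReal - ((φ₁ x).toReal + (φ₂ x).toReal) - 0 := by
        have : -(1 / (2 * η) * ‖y - x‖) * ‖y - x‖ = -(1 / (2 * η) * ‖y - x‖ ^ 2) := by ring
        linarith
      exact_mod_cast h3
end
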